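/- Let E be the intersection of the set of d-stochastic measures with finitely many Fréchet-class constraints P^(J)=S^J (J ∈ 𝒥) and finitely many expectation constraints ∫ g_K dP^(K) = α_K (K ∈ 𝒦). If there exists P ∈ E with I(P‖R) < ∞ for a given d-stochastic measure R, then the problem min_{P∈E} I(P‖R) admits a unique solution Q ∈ E, and moreover P ≪ Q ≪ R for every P ∈ E with I(P‖R) < ∞. -/

import Mathlib

open MeasureTheory Real BigOperators ENNReal

/-- Kullback–Leibler divergence (with value `∞` when `P` is not absolutely
continuous with respect to `Q` or the log-likelihood ratio is not integrable). -/
noncomputable def klDiv {α : Type*} [MeasurableSpace α] (P Q : Measure α) : ℝ≥0∞ :=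
  open scoped Classical in
  if P ≪ Q ∧ Integrable (MeasureTheory.llr P Q) P
  then ENNReal.ofReal (∫ x, MeasureTheory.llr P Q x ∂P) else ⊤

noncomputable def margin {d : ℕ} (P : Measure (Fin d → ℝ)) (J : Finset (Fin d)) :
    Measure (J → ℝ) :=
  P.map fun v (j : J) => v (j : Fin d)

/-- A `d`-stochastic measure: a probability measure on `[0,1]^d` (encoded by
all univariate margins being standard uniform). -/
def IsDStochastic {d : ℕ} (P : Measure (Fin d → ℝ)) : Prop :=
  IsProbabilityMeasure P ∧
    ∀ ℓ : Fin d, P.map (fun v => v ℓ) = volume.restrict (Set.Icc (0 : ℝ) 1)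

open InformationTheory (klFun)
open Filter Topology

lemma mul_log_sub_mul_log_ge {a m : ℝ} (ha : 0 ≤ a) (hm : 0 < m) :
    2 * (a - √a * √m) ≤ a * log a - a * log m := by
  rcases ha.eq_or_lt with rfl | ha
  · simp
  have hsa : 0 < √a := Real.sqrt_pos.2 ha
  have hsm : 0 < √m := Real.sqrt_pos.2 hm
  have h := Real.log_le_sub_one_of_pos (div_pos hsm hsa)
  rw [Real.log_div hsm.ne' hsa.ne', Real.log_sqrt hm.le, Real.log_sqrt ha.le] at h
  have h2 := mul_le_mul_of_nonneg_left h ha.le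
  have h3 : a * (√m / √a - 1) = √a * √m - a := by
    field_simp
    nlinarith [Real.sq_sqrt ha.le]
  nlinarith

/-- Strong midpoint convexity of `klFun`, measured by the Hellinger distance. -/
lemma sq_sqrt_sub_sqrt_le_klFun {a b : ℝ} (ha : 0 ≤ a) (hb : 0 ≤ b) :
    (√a - √b) ^ 2 / 2 ≤ klFun a + klFun b - 2 * klFun ((a + b) / 2) := by
  rcases (add_nonneg ha hb).eq_or_lt with h | h
  · have ha0 : a = 0 := by linarith
    have hb0 : b = 0 := by linarith
    simp [ha0, hb0, InformationTheory.klFun]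
    norm_num
  have hm : 0 < (a + b) / 2 := by linarith
  have h1 := mul_log_sub_mul_log_ge ha hm
  have h2 := mul_log_sub_mul_log_ge hb hm
  simp only [InformationTheory.klFun_apply]
  nlinarith [Real.sq_sqrt ha, Real.sq_sqrt hb, Real.sq_sqrt hm.le,
    sq_nonneg (√a + √b - 2 * √((a + b) / 2))]

lemma abs_sub_le_klFun {a b t : ℝ} (ha : 0 ≤ a) (hb : 0 ≤ b) (ht : 0 < t) :
    |a - b| ≤ (klFun a + klFun b - 2 * klFun ((a + b) / 2)) / t + t * (a + b) := by
  have h := sq_sqrt_sub_sqrt_le_klFun ha hb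
  have h1 : |a - b| = |√a - √b| * (√a + √b) := by
    rw [← abs_of_nonneg (add_nonneg (Real.sqrt_nonneg a) (Real.sqrt_nonneg b)), ← abs_mul]
    congr 1
    nlinarith [Real.sq_sqrt ha, Real.sq_sqrt hb]
  rw [h1, ← sub_le_iff_le_add, le_div_iff₀ ht]
  nlinarith [Real.sq_sqrt ha, Real.sq_sqrt hb, sq_abs (√a - √b),
    sq_nonneg (|√a - √b| - t * (√a + √b)), mul_nonneg (sq_nonneg t) (sq_nonneg (√a - √b))]

/-- Convexity of `klFun` along a segment, with the extra gain `t * p * log t` at points where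
the starting density vanishes. -/
lemma klFun_segment_le {p q t : ℝ} (hp : 0 ≤ p) (hq : 0 ≤ q) (ht : 0 < t) (ht1 : t ≤ 1) :
    klFun ((1 - t) * q + t * p) ≤
      (1 - t) * klFun q + t * klFun p + (if q = 0 then p else 0) * (t * log t) := by
  split_ifs with h
  · subst h
    rcases hp.eq_or_lt with rfl | hp
    · simp [InformationTheory.klFun]
    · simp only [InformationTheory.klFun_apply, mul_zero, zero_add, Real.log_mul ht.ne' hp.ne']
      nlinarith
  · have := InformationTheory.convexOn_klFun.2 (Set.mem_Ici.2 hq) (Set.mem_Ici.2 hp)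
      (sub_nonneg.2 ht1) ht.le (by ring)
    simpa using this

section Densities

variable {Ω : Type*} [MeasurableSpace Ω] {μ : Measure Ω}

lemma integrable_klFun_segment {p q : Ω → ℝ} {t : ℝ}
    (hpm : Measurable p) (hqm : Measurable q)
    (hp : 0 ≤ p) (hq : 0 ≤ q) (ht : 0 ≤ t) (ht1 : t ≤ 1)
    (hpi : Integrable (fun x => klFun (p x)) μ) (hqi : Integrable (fun x => klFun (q x)) μ) :
    Integrable (fun x => klFun ((1 - t) * q x + t * p x)) μ := by
  refine ((hqi.const_mul (1 - t)).add (hpi.const_mul t)).mono' ?_ (ae_of_all _ fun x => ?_)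
  · have : Measurable fun x => klFun ((1 - t) * q x + t * p x) := by fun_prop
    exact this.aestronglyMeasurable
  · have h0 : 0 ≤ (1 - t) * q x + t * p x :=
      add_nonneg (mul_nonneg (by linarith) (hq x)) (mul_nonneg ht (hp x))
    rw [Real.norm_of_nonneg (InformationTheory.klFun_nonneg h0)]
    have := InformationTheory.convexOn_klFun.2 (Set.mem_Ici.2 (hq x)) (Set.mem_Ici.2 (hp x))
      (sub_nonneg.2 ht1) ht (by ring)
    simpa using this

lemma integral_abs_sub_le_klFun {p q : Ω → ℝ} {m t : ℝ}
    (hp : 0 ≤ p) (hq : 0 ≤ q) (ht : 0 < t)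
    (hp1 : Integrable p μ) (hq1 : Integrable q μ) (hp2 : ∫ x, p x ∂μ = 1) (hq2 : ∫ x, q x ∂μ = 1)
    (hpi : Integrable (fun x => klFun (p x)) μ) (hqi : Integrable (fun x => klFun (q x)) μ)
    (hmi : Integrable (fun x => klFun ((p x + q x) / 2)) μ)
    (hm : m ≤ ∫ x, klFun ((p x + q x) / 2) ∂μ) :
    ∫ x, |p x - q x| ∂μ ≤
      (∫ x, klFun (p x) ∂μ + ∫ x, klFun (q x) ∂μ - 2 * m) / t + 2 * t := by
  have hi : Integrable (fun x => klFun (p x) + klFun (q x)) μ := hpi.add hqi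
  have hi2 : Integrable (fun x => klFun (p x) + klFun (q x) - 2 * klFun ((p x + q x) / 2)) μ :=
    hi.sub (hmi.const_mul 2)
  have hi3 : Integrable (fun x => p x + q x) μ := hp1.add hq1
  calc ∫ x, |p x - q x| ∂μ
      ≤ ∫ x, ((klFun (p x) + klFun (q x) - 2 * klFun ((p x + q x) / 2)) / t
          + t * (p x + q x)) ∂μ :=
        integral_mono (hp1.sub hq1).abs ((hi2.div_const t).add (hi3.const_mul t))
          fun x => abs_sub_le_klFun (hp x) (hq x) ht
    _ = (∫ x, klFun (p x) ∂μ + ∫ x, klFun (q x) ∂μ - 2 * ∫ x, klFun ((p x + q x) / 2) ∂μ) / t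
          + 2 * t := by
        rw [integral_add (hi2.div_const t) (hi3.const_mul t), integral_div,
          integral_sub hi (hmi.const_mul 2), integral_add hpi hqi, integral_const_mul,
          integral_const_mul, integral_add hp1 hq1, hp2, hq2]
        ring
    _ ≤ _ := by gcongr

/-- A sequence of nonnegative densities that is Cauchy in mean has a limit in mean, which is
almost everywhere the pointwise limit of a subsequence. -/
lemma exists_density_limit {f : ℕ → Ω → ℝ} (hf0 : ∀ n, 0 ≤ f n) (hfi : ∀ n, Integrable (f n) μ)
    (hc : ∀ N n m, N ≤ n → N ≤ m → ∫ x, |f n x - f m x| ∂μ < (1 / 2) ^ N) :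
    ∃ q : Ω → ℝ, Measurable q ∧ 0 ≤ q ∧ Integrable q μ ∧
      Tendsto (fun n => ∫ x, |f n x - q x| ∂μ) atTop (𝓝 0) ∧
      ∃ φ : ℕ → ℕ, StrictMono φ ∧ ∀ᵐ x ∂μ, Tendsto (fun n => f (φ n) x) atTop (𝓝 (q x)) := by
  have hnorm : ∀ {g : Ω → ℝ}, Integrable g μ → eLpNorm g 1 μ = ENNReal.ofReal (∫ x, |g x| ∂μ) := by
    intro g hg
    rw [eLpNorm_one_eq_lintegral_enorm, ofReal_integral_eq_lintegral_ofReal hg.abs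
      (ae_of_all _ fun x => abs_nonneg _)]
    simp [← Real.enorm_eq_ofReal_abs]
  obtain ⟨u, hu, hlim⟩ := Lp.cauchy_complete_eLpNorm (μ := μ) (p := 1) (f := f) le_rfl
    (fun n => memLp_one_iff_integrable.2 (hfi n)) (B := fun N => ENNReal.ofReal ((1 / 2) ^ N))
    (by
      rw [← ENNReal.ofReal_tsum_of_nonneg (fun n => by positivity) summable_geometric_two]
      exact ENNReal.ofReal_ne_top)
    (fun N n m hn hm => by
      rw [hnorm ((hfi n).sub (hfi m))]
      exact (ENNReal.ofReal_lt_ofReal_iff (by positivity)).2 (hc N n m hn hm))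
  obtain ⟨φ, hφ, hae⟩ := (tendstoInMeasure_of_tendsto_eLpNorm one_ne_zero
    (fun n => (hfi n).aestronglyMeasurable) hu.1 hlim).exists_seq_tendsto_ae
  have hui : Integrable u μ := memLp_one_iff_integrable.1 hu
  let q : Ω → ℝ := fun x => max 0 (hu.1.mk u x)
  have hqm : Measurable q := measurable_const.max hu.1.stronglyMeasurable_mk.measurable
  have hqu : q =ᵐ[μ] u := by
    filter_upwards [hae, hu.1.ae_eq_mk] with x hx hx'
    have : 0 ≤ u x := ge_of_tendsto' hx fun n => hf0 _ x
    simp [q, ← hx', this]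
  have hqi : Integrable q μ := hui.congr hqu.symm
  refine ⟨q, hqm, fun x => le_max_left _ _, hqi, ?_, φ, hφ, ?_⟩
  · have h2 : Tendsto (fun n => (eLpNorm (f n - u) 1 μ).toReal) atTop (𝓝 0) := by
      simpa [Function.comp_def] using (ENNReal.tendsto_toReal zero_ne_top).comp hlim
    refine h2.congr fun n => ?_
    rw [hnorm ((hfi n).sub hui), ENNReal.toReal_ofReal (integral_nonneg fun x => abs_nonneg _)]
    refine integral_congr_ae ?_
    filter_upwards [hqu] with x hx
    simp [hx]
  · filter_upwards [hae, hqu] with x hx hx'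
    rwa [hx']

/-- Fatou's lemma for the divergence integral. -/
lemma integral_klFun_le_of_tendsto {f : ℕ → Ω → ℝ} {q : Ω → ℝ} {m : ℝ}
    (hfm : ∀ n, Measurable (f n)) (hf0 : ∀ n, 0 ≤ f n) (hqm : Measurable q) (hq0 : 0 ≤ q)
    (hfk : ∀ n, Integrable (fun x => klFun (f n x)) μ)
    (hae : ∀ᵐ x ∂μ, Tendsto (fun n => f n x) atTop (𝓝 (q x)))
    (hm : Tendsto (fun n => ∫ x, klFun (f n x) ∂μ) atTop (𝓝 m)) :
    Integrable (fun x => klFun (q x)) μ ∧ ∫ x, klFun (q x) ∂μ ≤ m := by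
  have hnn : ∀ x, 0 ≤ klFun (q x) := fun x => InformationTheory.klFun_nonneg (hq0 x)
  have hle : ∫⁻ x, ENNReal.ofReal (klFun (q x)) ∂μ ≤ ENNReal.ofReal m := by
    calc ∫⁻ x, ENNReal.ofReal (klFun (q x)) ∂μ
        = ∫⁻ x, liminf (fun n => ENNReal.ofReal (klFun (f n x))) atTop ∂μ := by
          refine lintegral_congr_ae ?_
          filter_upwards [hae] with x hx
          exact ((ENNReal.tendsto_ofReal
            ((InformationTheory.continuous_klFun.tendsto _).comp hx)).liminf_eq).symm
      _ ≤ liminf (fun n => ∫⁻ x, ENNReal.ofReal (klFun (f n x)) ∂μ) atTop :=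
          lintegral_liminf_le fun n => by have := hfm n; fun_prop
      _ = ENNReal.ofReal m := by
          refine Tendsto.liminf_eq ((ENNReal.tendsto_ofReal hm).congr fun n => ?_)
          exact ofReal_integral_eq_lintegral_ofReal (hfk n)
            (ae_of_all _ fun x => InformationTheory.klFun_nonneg (hf0 n x))
  have hmeas : AEStronglyMeasurable (fun x => klFun (q x)) μ := by
    have : Measurable (fun x => klFun (q x)) := by fun_prop
    exact this.aestronglyMeasurable
  have hint : Integrable (fun x => klFun (q x)) μ :=
    ⟨hmeas, (hasFiniteIntegral_iff_ofReal (ae_of_all _ hnn)).2 (hle.trans_lt ofReal_lt_top)⟩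
  refine ⟨hint, ?_⟩
  rw [← ofReal_integral_eq_lintegral_ofReal hint (ae_of_all _ hnn)] at hle
  have hm0 : 0 ≤ m := ge_of_tendsto' hm fun n =>
    integral_nonneg fun x => InformationTheory.klFun_nonneg (hf0 n x)
  exact (ENNReal.ofReal_le_ofReal_iff hm0).1 hle

/-- Existence, uniqueness and support of the I-projection, in terms of densities with respect
to the reference measure. -/
theorem exists_density_iProjection {F : Set (Ω → ℝ)}
    (hmeas : ∀ f ∈ F, Measurable f) (hnonneg : ∀ f ∈ F, 0 ≤ f)
    (hint : ∀ f ∈ F, Integrable f μ) (hone : ∀ f ∈ F, ∫ x, f x ∂μ = 1)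
    (hconv : ∀ f ∈ F, ∀ g ∈ F, ∀ t : ℝ, 0 ≤ t → t ≤ 1 →
      (fun x => (1 - t) * g x + t * f x) ∈ F)
    (hclosed : ∀ (f : ℕ → Ω → ℝ) (q : Ω → ℝ), (∀ n, f n ∈ F) → Measurable q → 0 ≤ q →
      Integrable q μ → Tendsto (fun n => ∫ x, |f n x - q x| ∂μ) atTop (𝓝 0) → q ∈ F)
    (hfeas : ∃ f ∈ F, Integrable (fun x => klFun (f x)) μ) :
    ∃ q ∈ F, Integrable (fun x => klFun (q x)) μ ∧
      (∀ p ∈ F, Integrable (fun x => klFun (p x)) μ →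
        ∫ x, klFun (q x) ∂μ ≤ ∫ x, klFun (p x) ∂μ) ∧
      (∀ p ∈ F, Integrable (fun x => klFun (p x)) μ → ∀ᵐ x ∂μ, q x = 0 → p x = 0) ∧
      (∀ p ∈ F, Integrable (fun x => klFun (p x)) μ →
        ∫ x, klFun (p x) ∂μ ≤ ∫ x, klFun (q x) ∂μ → p =ᵐ[μ] q) := by
  let F₀ : Set (Ω → ℝ) := {f ∈ F | Integrable (fun x => klFun (f x)) μ}
  let D : (Ω → ℝ) → ℝ := fun f => ∫ x, klFun (f x) ∂μ
  have hne : (D '' F₀).Nonempty := hfeas.elim fun f hf => ⟨_, f, hf, rfl⟩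
  have hD0 : ∀ f ∈ F₀, 0 ≤ D f := fun f hf =>
    integral_nonneg fun x => InformationTheory.klFun_nonneg (hnonneg f hf.1 x)
  have hbdd : BddBelow (D '' F₀) := ⟨0, by rintro _ ⟨f, hf, rfl⟩; exact hD0 f hf⟩
  set m := sInf (D '' F₀)
  have hmle : ∀ f ∈ F₀, m ≤ D f := fun f hf => csInf_le hbdd ⟨f, hf, rfl⟩
  have hconv' : ∀ f ∈ F₀, ∀ g ∈ F₀, ∀ t : ℝ, 0 ≤ t → t ≤ 1 →
      (fun x => (1 - t) * g x + t * f x) ∈ F₀ := fun f hf g hg t ht ht1 =>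
    ⟨hconv f hf.1 g hg.1 t ht ht1, integrable_klFun_segment (hmeas f hf.1) (hmeas g hg.1)
      (hnonneg f hf.1) (hnonneg g hg.1) ht ht1 hf.2 hg.2⟩
  have hdist : ∀ f ∈ F₀, ∀ g ∈ F₀, ∀ t > 0,
      ∫ x, |f x - g x| ∂μ ≤ (D f + D g - 2 * m) / t + 2 * t := by
    intro f hf g hg t ht
    have hmid : (fun x => (f x + g x) / 2) ∈ F₀ := by
      convert hconv' f hf g hg (1 / 2) (by norm_num) (by norm_num) using 2
      ring
    exact integral_abs_sub_le_klFun (hnonneg f hf.1) (hnonneg g hg.1) ht (hint f hf.1)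
      (hint g hg.1) (hone f hf.1) (hone g hg.1) hf.2 hg.2 hmid.2 (hmle _ hmid)
  let δ : ℕ → ℝ := fun N => (1 / 2) ^ N / 8
  have hδ : ∀ N, 0 < δ N := fun N => by positivity
  have hδanti : ∀ N n, N ≤ n → δ n ≤ δ N := fun N n h =>
    div_le_div_of_nonneg_right (pow_le_pow_of_le_one (by norm_num) (by norm_num) h) (by norm_num)
  have hex : ∀ n, ∃ f ∈ F₀, D f < m + δ n ^ 2 := by
    intro n
    obtain ⟨_, ⟨f, hf, rfl⟩, h⟩ := exists_lt_of_csInf_lt hne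
      (lt_add_of_pos_right m (pow_pos (hδ n) 2))
    exact ⟨f, hf, h⟩
  choose f hf hfD using hex
  obtain ⟨q, hqm, hq0, hqi, hqlim, φ, hφ, hae⟩ := exists_density_limit (μ := μ) (f := f)
    (fun n => hnonneg _ (hf n).1) (fun n => hint _ (hf n).1) (by
      intro N n k hn hk
      have h1 := hdist _ (hf n) _ (hf k) (δ N) (hδ N)
      have h2 : (D (f n) + D (f k) - 2 * m) / δ N ≤ 2 * δ N := by
        rw [div_le_iff₀ (hδ N)]
        have := pow_le_pow_left₀ (hδ n).le (hδanti N n hn) 2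
        have := pow_le_pow_left₀ (hδ k).le (hδanti N k hk) 2
        nlinarith [hfD n, hfD k]
      have h3 : δ N * 8 = (1 / 2) ^ N := div_mul_cancel₀ _ (by norm_num)
      linarith [hδ N])
  have hqF : q ∈ F := hclosed f q (fun n => (hf n).1) hqm hq0 hqi hqlim
  have hDlim : Tendsto (fun n => D (f n)) atTop (𝓝 m) := by
    have hδ0 : Tendsto (fun n => m + δ n ^ 2) atTop (𝓝 m) := by
      have h : Tendsto (fun n : ℕ => ((1 : ℝ) / 2) ^ n) atTop (𝓝 0) :=
        tendsto_pow_atTop_nhds_zero_of_lt_one (by norm_num) (by norm_num)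
      simpa [δ] using ((h.div_const 8).pow 2).const_add m
    exact tendsto_of_tendsto_of_tendsto_of_le_of_le tendsto_const_nhds hδ0
      (fun n => hmle _ (hf n)) (fun n => (hfD n).le)
  obtain ⟨hqk, hqD⟩ := integral_klFun_le_of_tendsto (fun n => hmeas _ (hf (φ n)).1)
    (fun n => hnonneg _ (hf (φ n)).1) hqm hq0 (fun n => (hf (φ n)).2) hae
    (hDlim.comp hφ.tendsto_atTop)
  have hqF₀ : q ∈ F₀ := ⟨hqF, hqk⟩
  have hqmin : ∀ p ∈ F₀, D q ≤ D p := fun p hp => hqD.trans (hmle p hp)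
  refine ⟨q, hqF, hqk, fun p hp hpk => hqmin p ⟨hp, hpk⟩, fun p hp hpk => ?_,
    fun p hp hpk hle => ?_⟩
  · let h : Ω → ℝ := fun x => if q x = 0 then p x else 0
    have hh0 : 0 ≤ h := fun x => by
      simp only [h]; split_ifs
      · exact hnonneg p hp x
      · exact le_rfl
    have hhi : Integrable h μ := by
      have : h = (q ⁻¹' {0}).indicator p := by
        classical
        ext x
        rw [Set.indicator_apply]
        rfl
      rw [this]
      exact (hint p hp).indicator (hqm (measurableSet_singleton 0))
    have hzero : ∫ x, h x ∂μ = 0 := by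
      by_contra hne0
      have hpos : 0 < ∫ x, h x ∂μ := lt_of_le_of_ne (integral_nonneg hh0) (Ne.symm hne0)
      set c := ∫ x, h x ∂μ
      have hDp := hD0 p ⟨hp, hpk⟩
      have hDq := hD0 q hqF₀
      let t : ℝ := exp (-((D p + 1) / c))
      have ht : 0 < t := exp_pos _
      have ht1 : t ≤ 1 := exp_le_one_iff.2 (neg_nonpos.2 (by positivity))
      have hseg := hconv' p ⟨hp, hpk⟩ q hqF₀ t ht.le ht1
      have h1 : D q ≤ (1 - t) * D q + t * D p + c * (t * log t) := by
        have hia : Integrable (fun x => (1 - t) * klFun (q x) + t * klFun (p x)) μ :=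
          (hqk.const_mul (1 - t)).add (hpk.const_mul t)
        calc D q ≤ ∫ x, klFun ((1 - t) * q x + t * p x) ∂μ := hqmin _ hseg
          _ ≤ ∫ x, ((1 - t) * klFun (q x) + t * klFun (p x) + h x * (t * log t)) ∂μ :=
              integral_mono hseg.2 (hia.add (hhi.mul_const _))
                fun x => klFun_segment_le (hnonneg p hp x) (hq0 x) ht ht1
          _ = _ := by
              rw [integral_add hia (hhi.mul_const _),
                integral_add (hqk.const_mul (1 - t)) (hpk.const_mul t), integral_const_mul,
                integral_const_mul, integral_mul_const]
      have h2 : c * log t = -(D p + 1) := by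
        simp only [t, Real.log_exp]
        field_simp
      have h3 : 0 ≤ t * (D p - D q + c * log t) := by linarith
      rw [h2] at h3
      have := nonneg_of_mul_nonneg_right h3 ht
      linarith
    filter_upwards [(integral_eq_zero_iff_of_nonneg hh0 hhi).1 hzero] with x hx hqx
    simpa [h, hqx] using hx
  · have hpF₀ : p ∈ F₀ := ⟨hp, hpk⟩
    have hI : ∫ x, |p x - q x| ∂μ = 0 := by
      refine le_antisymm (le_of_forall_pos_le_add fun ε hε => ?_)
        (integral_nonneg fun x => abs_nonneg _)
      have h1 := hdist p hpF₀ q hqF₀ (ε / 2) (by positivity)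
      have h2 : (D p + D q - 2 * m) / (ε / 2) ≤ 0 :=
        div_nonpos_of_nonpos_of_nonneg (by change D p ≤ D q at hle; linarith) (by positivity)
      linarith
    have := (integral_eq_zero_iff_of_nonneg (fun x => abs_nonneg _)
      ((hint p hp).sub hqi).abs).1 hI
    filter_upwards [this] with x hx
    simpa [sub_eq_zero] using hx


lemma klDiv_withDensity [IsProbabilityMeasure μ] {f : Ω → ℝ} (hfm : Measurable f) (hf0 : 0 ≤ f)
    [IsProbabilityMeasure (μ.withDensity fun x => ENNReal.ofReal (f x))] :
    klDiv (μ.withDensity fun x => ENNReal.ofReal (f x)) μ =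
      open scoped Classical in
      if Integrable (fun x => klFun (f x)) μ then ENNReal.ofReal (∫ x, klFun (f x) ∂μ) else ⊤ := by
  classical
  set P := μ.withDensity fun x => ENNReal.ofReal (f x) with hP
  have hac : P ≪ μ := withDensity_absolutelyContinuous _ _
  have hrn : (fun x => klFun (P.rnDeriv μ x).toReal) =ᵐ[μ] fun x => klFun (f x) := by
    filter_upwards [Measure.rnDeriv_withDensity μ hfm.ennreal_ofReal] with x hx
    rw [hx, ENNReal.toReal_ofReal (hf0 x)]
  have hiff : Integrable (fun x => klFun (f x)) μ ↔ Integrable (llr P μ) P := by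
    rw [← InformationTheory.integrable_klFun_rnDeriv_iff hac, integrable_congr hrn]
  by_cases h : Integrable (llr P μ) P
  · have h1 := InformationTheory.integral_klFun_rnDeriv hac h
    rw [integral_congr_ae hrn] at h1
    simp only [klDiv, hac, h, hiff, h1]
    simp
  · simp only [klDiv, hac, h, hiff]
    simp

lemma exists_density_of_absolutelyContinuous [SigmaFinite μ] {P : Measure Ω} [IsFiniteMeasure P]
    (h : P ≪ μ) : ∃ f : Ω → ℝ, Measurable f ∧ 0 ≤ f ∧ Integrable f μ ∧
      P = μ.withDensity fun x => ENNReal.ofReal (f x) := by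
  refine ⟨fun x => (P.rnDeriv μ x).toReal, (Measure.measurable_rnDeriv P μ).ennreal_toReal,
    fun x => ENNReal.toReal_nonneg, Measure.integrable_toReal_rnDeriv, ?_⟩
  conv_lhs => rw [← Measure.withDensity_rnDeriv_eq P μ h]
  refine withDensity_congr_ae ?_
  filter_upwards [Measure.rnDeriv_lt_top P μ] with x hx
  rw [ENNReal.ofReal_toReal hx.ne]

lemma integral_withDensity_ofReal {f G : Ω → ℝ} (hfm : Measurable f) (hf0 : 0 ≤ f) :
    ∫ x, G x ∂(μ.withDensity fun x => ENNReal.ofReal (f x)) = ∫ x, f x * G x ∂μ := by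
  rw [integral_withDensity_eq_integral_toReal_smul hfm.ennreal_ofReal
    (ae_of_all _ fun x => ENNReal.ofReal_lt_top)]
  simp [ENNReal.toReal_ofReal (hf0 _)]

/-- The I-projection of a probability measure onto a set of probability measures cut out by
linear constraints with essentially bounded integrands. -/
theorem exists_iProjection_of_integral_constraints [IsProbabilityMeasure μ]
    {E : Set (Measure Ω)} {C : Set ((Ω → ℝ) × ℝ)}
    (hprob : ∀ P ∈ E, IsProbabilityMeasure P)
    (hCm : ∀ c ∈ C, AEStronglyMeasurable c.1 μ)
    (hCb : ∀ c ∈ C, ∃ M, ∀ᵐ x ∂μ, ‖c.1 x‖ ≤ M)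
    (hE : ∀ P : Measure Ω, IsFiniteMeasure P → P ≪ μ →
      (P ∈ E ↔ ∀ c ∈ C, ∫ x, c.1 x ∂P = c.2))
    (hfeas : ∃ P ∈ E, klDiv P μ < ⊤) :
    ∃ Q ∈ E, klDiv Q μ < ⊤ ∧ (∀ P ∈ E, klDiv Q μ ≤ klDiv P μ) ∧ Q ≪ μ ∧
      (∀ P ∈ E, klDiv P μ < ⊤ → P ≪ Q) ∧
      (∀ Q' ∈ E, (∀ P ∈ E, klDiv Q' μ ≤ klDiv P μ) → Q' = Q) := by
  classical
  let T : (Ω → ℝ) → Measure Ω := fun f => μ.withDensity fun x => ENNReal.ofReal (f x)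
  have hTac : ∀ f, T f ≪ μ := fun f => withDensity_absolutelyContinuous _ _
  let F : Set (Ω → ℝ) := {f | Measurable f ∧ 0 ≤ f ∧ Integrable f μ ∧ T f ∈ E}
  have hiff : ∀ f : Ω → ℝ, Measurable f → 0 ≤ f → Integrable f μ →
      (T f ∈ E ↔ ∀ c ∈ C, ∫ x, f x * c.1 x ∂μ = c.2) := by
    intro f hfm hf0 hfi
    have hfin : IsFiniteMeasure (T f) := isFiniteMeasure_withDensity_ofReal hfi.2
    rw [hE _ hfin (hTac f)]
    simp only [T, integral_withDensity_ofReal hfm hf0]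
  have hmulint : ∀ f : Ω → ℝ, Integrable f μ → ∀ c ∈ C, Integrable (fun x => f x * c.1 x) μ := by
    intro f hf c hc
    obtain ⟨M, hM⟩ := hCb c hc
    exact hf.mul_bdd (hCm c hc) hM
  have hkl : ∀ f ∈ F, klDiv (T f) μ =
      if Integrable (fun x => klFun (f x)) μ then ENNReal.ofReal (∫ x, klFun (f x) ∂μ) else ⊤ := by
    intro f hf
    have := hprob _ hf.2.2.2
    exact klDiv_withDensity hf.1 hf.2.1
  have hklint : ∀ f ∈ F, klDiv (T f) μ < ⊤ → Integrable (fun x => klFun (f x)) μ := by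
    intro f hf h
    by_contra hn
    simp [hkl f hf, hn] at h
  have hrep : ∀ P ∈ E, klDiv P μ < ⊤ →
      ∃ f ∈ F, P = T f ∧ Integrable (fun x => klFun (f x)) μ := by
    intro P hP h
    have := hprob P hP
    have hac : P ≪ μ := by
      by_contra hn
      simp [klDiv, hn] at h
    obtain ⟨f, hfm, hf0, hfi, rfl⟩ := exists_density_of_absolutelyContinuous hac
    have hf : f ∈ F := ⟨hfm, hf0, hfi, hP⟩
    exact ⟨f, hf, rfl, hklint f hf h⟩
  have hone : ∀ f ∈ F, ∫ x, f x ∂μ = 1 := by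
    intro f hf
    have := hprob _ hf.2.2.2
    have h := integral_withDensity_ofReal (μ := μ) (G := fun _ => 1) hf.1 hf.2.1
    simpa [T] using h.symm
  obtain ⟨q, hqF, hqk, hqmin, hqsupp, hquniq⟩ := exists_density_iProjection (μ := μ) (F := F)
    (fun f hf => hf.1) (fun f hf => hf.2.1) (fun f hf => hf.2.2.1) hone
    (by
      rintro f ⟨hfm, hf0, hfi, hfE⟩ g ⟨hgm, hg0, hgi, hgE⟩ t ht ht1
      have hm : Measurable fun x => (1 - t) * g x + t * f x := by fun_prop
      have h0 : 0 ≤ fun x => (1 - t) * g x + t * f x := fun x =>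
        add_nonneg (mul_nonneg (sub_nonneg.2 ht1) (hg0 x)) (mul_nonneg ht (hf0 x))
      have hi : Integrable (fun x => (1 - t) * g x + t * f x) μ :=
        (hgi.const_mul _).add (hfi.const_mul _)
      refine ⟨hm, h0, hi, (hiff _ hm h0 hi).2 fun c hc => ?_⟩
      have e : (fun x => ((1 - t) * g x + t * f x) * c.1 x) =
          fun x => (1 - t) * (g x * c.1 x) + t * (f x * c.1 x) := by
        ext x; ring
      rw [e, integral_add ((hmulint g hgi c hc).const_mul _) ((hmulint f hfi c hc).const_mul _),
        integral_const_mul, integral_const_mul, (hiff f hfm hf0 hfi).1 hfE c hc,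
        (hiff g hgm hg0 hgi).1 hgE c hc]
      ring)
    (by
      intro f q hf hqm hq0 hqi hlim
      refine ⟨hqm, hq0, hqi, (hiff q hqm hq0 hqi).2 fun c hc => ?_⟩
      obtain ⟨M, hM⟩ := hCb c hc
      have hconst : ∀ n, ∫ x, f n x * c.1 x ∂μ = c.2 := fun n =>
        (hiff _ (hf n).1 (hf n).2.1 (hf n).2.2.1).1 (hf n).2.2.2 c hc
      have hbound : ∀ n, |c.2 - ∫ x, q x * c.1 x ∂μ| ≤ (∫ x, |f n x - q x| ∂μ) * M := by
        intro n
        rw [← hconst n, ← integral_sub (hmulint _ (hf n).2.2.1 c hc) (hmulint q hqi c hc),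
          ← integral_mul_const, ← Real.norm_eq_abs]
        refine norm_integral_le_of_norm_le (((hf n).2.2.1.sub hqi).abs.mul_const M) ?_
        filter_upwards [hM] with x hx
        rw [← sub_mul, norm_mul]
        exact mul_le_mul_of_nonneg_left hx (norm_nonneg _)
      have h0 : |c.2 - ∫ x, q x * c.1 x ∂μ| ≤ 0 :=
        ge_of_tendsto' (by simpa using hlim.mul_const M) hbound
      linarith [abs_nonpos_iff.1 h0])
    (by
      obtain ⟨P, hP, h⟩ := hfeas
      obtain ⟨f, hf, -, hfk⟩ := hrep P hP h
      exact ⟨f, hf, hfk⟩)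
  have hQ : klDiv (T q) μ = ENNReal.ofReal (∫ x, klFun (q x) ∂μ) := by rw [hkl q hqF, if_pos hqk]
  refine ⟨T q, hqF.2.2.2, hQ ▸ ENNReal.ofReal_lt_top, fun P hP => ?_, hTac q, fun P hP h => ?_,
    fun Q' hQ' hmin => ?_⟩
  · by_cases h : klDiv P μ < ⊤
    · obtain ⟨p, hp, rfl, hpk⟩ := hrep P hP h
      rw [hQ, hkl p hp, if_pos hpk]
      exact ENNReal.ofReal_le_ofReal (hqmin p hp hpk)
    · rw [not_lt_top_iff.1 h]
      exact le_top
  · obtain ⟨p, hp, rfl, hpk⟩ := hrep P hP h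
    refine Measure.AbsolutelyContinuous.mk fun s hs hs0 => ?_
    rw [withDensity_apply _ hs, lintegral_eq_zero_iff hqF.1.ennreal_ofReal] at hs0
    rw [withDensity_apply _ hs, lintegral_eq_zero_iff hp.1.ennreal_ofReal]
    filter_upwards [hs0, ae_restrict_of_ae (hqsupp p hp hpk)] with x hx hx'
    have hqx : q x = 0 := le_antisymm (ENNReal.ofReal_eq_zero.1 hx) (hqF.2.1 x)
    simp [hx' hqx]
  · have hle := hmin _ hqF.2.2.2
    obtain ⟨p, hp, rfl, hpk⟩ := hrep Q' hQ' (hle.trans_lt (hQ ▸ ENNReal.ofReal_lt_top))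
    rw [hQ, hkl p hp, if_pos hpk, ENNReal.ofReal_le_ofReal_iff
      (integral_nonneg fun x => InformationTheory.klFun_nonneg (hqF.2.1 x))] at hle
    refine withDensity_congr_ae ?_
    filter_upwards [hquniq p hp hpk hle] with x hx
    rw [hx]

end Densities

section Constraints

variable {Ω Ω' : Type*} [MeasurableSpace Ω] [MeasurableSpace Ω']

lemma map_eq_iff_integral_indicator {P : Measure Ω} [IsFiniteMeasure P] {ν : Measure Ω'}
    [IsFiniteMeasure ν] {h : Ω → Ω'} (hh : Measurable h) :
    P.map h = ν ↔ ∀ s, MeasurableSet s →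
      ∫ x, (h ⁻¹' s).indicator (fun _ => (1 : ℝ)) x ∂P = ν.real s := by
  rw [Measure.ext_iff]
  refine forall₂_congr fun s hs => ?_
  rw [integral_indicator (hh hs), setIntegral_const, smul_eq_mul, mul_one, measureReal_def,
    measureReal_def, ENNReal.toReal_eq_toReal_iff' (measure_ne_top _ _) (measure_ne_top _ _),
    Measure.map_apply hh hs]

lemma isProbabilityMeasure_iff_integral_one {P : Measure Ω} :
    IsProbabilityMeasure P ↔ ∫ _, (1 : ℝ) ∂P = 1 := by
  rw [integral_const, smul_eq_mul, mul_one, isProbabilityMeasure_iff_real]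

end Constraints

lemma measurable_restrict_coords {d : ℕ} (K : Finset (Fin d)) :
    Measurable fun (v : Fin d → ℝ) (j : K) => v (j : Fin d) := by
  fun_prop

lemma IsDStochastic.ae_mem_cube {d : ℕ} {R : Measure (Fin d → ℝ)} (hR : IsDStochastic R)
    (K : Finset (Fin d)) :
    ∀ᵐ x ∂(margin R K), x ∈ Set.univ.pi fun _ : K => Set.Icc (0 : ℝ) 1 := by
  have hmeas : MeasurableSet (Set.univ.pi fun _ : K => Set.Icc (0 : ℝ) 1) :=
    MeasurableSet.univ_pi fun _ => measurableSet_Icc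
  refine (ae_map_iff (measurable_restrict_coords K).aemeasurable hmeas).2 ?_
  have hcoord : ∀ j : Fin d, ∀ᵐ v ∂ R, v j ∈ Set.Icc (0 : ℝ) 1 := by
    intro j
    refine ae_of_ae_map (f := fun v : Fin d → ℝ => v j) (measurable_pi_apply j).aemeasurable ?_
    rw [hR.2 j]
    exact ae_restrict_mem measurableSet_Icc
  filter_upwards [ae_all_iff.2 hcoord] with v hv
  exact fun j _ => hv j

lemma IsDStochastic.aestronglyMeasurable_margin {d : ℕ} {R : Measure (Fin d → ℝ)}
    (hR : IsDStochastic R) {K : Finset (Fin d)} {g : (K → ℝ) → ℝ}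
    (hg : ContinuousOn g (Set.univ.pi fun _ : K => Set.Icc (0 : ℝ) 1)) :
    AEStronglyMeasurable g (margin R K) := by
  rw [← Measure.restrict_eq_self_of_ae_mem (hR.ae_mem_cube K)]
  exact hg.aestronglyMeasurable (MeasurableSet.univ_pi fun _ => measurableSet_Icc)

/-- The generalized minimum information copula problem: if some `P` in the
constraint set `E` has `I(P‖R) < ∞`, then `min_{P ∈ E} I(P‖R)` admits a unique
solution `Q ∈ E`, and `P ≪ Q ≪ R` for every `P ∈ E` with `I(P‖R) < ∞`. -/
theorem generalized_minimum_information_copula_problem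
    (d : ℕ) (hd : 2 ≤ d)
    (𝒥 𝒦 : Finset (Finset (Fin d))) (hdisj : Disjoint 𝒥 𝒦)
    (h𝒥card : ∀ J ∈ 𝒥, 2 ≤ J.card) (h𝒦card : ∀ K ∈ 𝒦, 2 ≤ K.card)
    (S : (J : Finset (Fin d)) → Measure (J → ℝ))
    (hS : ∀ J ∈ 𝒥, IsProbabilityMeasure (S J) ∧
      ∀ j : J, (S J).map (fun x => x j) = volume.restrict (Set.Icc (0 : ℝ) 1))
    (g : (K : Finset (Fin d)) → (K → ℝ) → ℝ)
    (hg : ∀ K ∈ 𝒦, ContinuousOn (g K) (Set.univ.pi fun _ : K => Set.Icc (0 : ℝ) 1))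
    (α : Finset (Fin d) → ℝ)
    (R : Measure (Fin d → ℝ)) (hR : IsDStochastic R)
    (E : Set (Measure (Fin d → ℝ)))
    (hE : E = {P | IsDStochastic P ∧ (∀ J ∈ 𝒥, margin P J = S J) ∧
      (∀ K ∈ 𝒦, ∫ x, g K x ∂(margin P K) = α K)})
    (hfeas : ∃ P ∈ E, klDiv P R < ⊤) :
    ∃ Q ∈ E,
      klDiv Q R < ⊤ ∧
      (∀ P ∈ E, klDiv Q R ≤ klDiv P R) ∧
      Q ≪ R ∧
      (∀ P ∈ E, klDiv P R < ⊤ → P ≪ Q) ∧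
      (∀ Q' ∈ E, (∀ P ∈ E, klDiv Q' R ≤ klDiv P R) → Q' = Q) := by
  have hRprob : IsProbabilityMeasure R := hR.1
  subst hE
  let C : Set (((Fin d → ℝ) → ℝ) × ℝ) :=
    {c | c = (fun _ => 1, 1) ∨
      (∃ ℓ : Fin d, ∃ s : Set ℝ, MeasurableSet s ∧
        c = (((fun v : Fin d → ℝ => v ℓ) ⁻¹' s).indicator (fun _ => 1),
          (volume.restrict (Set.Icc (0 : ℝ) 1)).real s)) ∨
      (∃ J ∈ 𝒥, ∃ s : Set (J → ℝ), MeasurableSet s ∧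
        c = (((fun (v : Fin d → ℝ) (j : J) => v (j : Fin d)) ⁻¹' s).indicator (fun _ => 1),
          (S J).real s)) ∨
      (∃ K ∈ 𝒦, c = (fun v => g K fun j : K => v (j : Fin d), α K))}
  have hind : ∀ s : Set (Fin d → ℝ), ∀ x, ‖s.indicator (fun _ => (1 : ℝ)) x‖ ≤ 1 := fun s x =>
    (norm_indicator_le_norm_self _ _).trans (by simp)
  refine exists_iProjection_of_integral_constraints (C := C) (fun P hP => hP.1.1) ?_ ?_ ?_ hfeas
  · rintro c (rfl | ⟨ℓ, s, hs, rfl⟩ | ⟨J, hJ, s, hs, rfl⟩ | ⟨K, hK, rfl⟩)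
    · exact aestronglyMeasurable_const
    · exact aestronglyMeasurable_const.indicator (measurable_pi_apply ℓ hs)
    · exact aestronglyMeasurable_const.indicator (measurable_restrict_coords J hs)
    · exact (hR.aestronglyMeasurable_margin (hg K hK)).comp_measurable
        (measurable_restrict_coords K)
  · rintro c (rfl | ⟨ℓ, s, hs, rfl⟩ | ⟨J, hJ, s, hs, rfl⟩ | ⟨K, hK, rfl⟩)
    · exact ⟨1, ae_of_all _ fun x => by simp⟩
    · exact ⟨1, ae_of_all _ (hind _)⟩
    · exact ⟨1, ae_of_all _ (hind _)⟩
    · obtain ⟨M, hM⟩ := (isCompact_univ_pi fun _ : K => isCompact_Icc).exists_bound_of_continuousOn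
        (hg K hK)
      refine ⟨M, ?_⟩
      filter_upwards [ae_of_ae_map (measurable_restrict_coords K).aemeasurable
        (hR.ae_mem_cube K)] with v hv
      exact hM _ hv
  · intro P hP hac
    have hgint : ∀ K ∈ 𝒦,
        ∫ x, g K x ∂(margin P K) = ∫ v, g K (fun j : K => v (j : Fin d)) ∂P := fun K hK =>
      integral_map (measurable_restrict_coords K).aemeasurable
        ((hR.aestronglyMeasurable_margin (hg K hK)).mono_ac
          (hac.map (measurable_restrict_coords K)))
    have hmargin : ∀ J ∈ 𝒥, (margin P J = S J ↔ ∀ s, MeasurableSet s →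
        ∫ x, ((fun (v : Fin d → ℝ) (j : J) => v (j : Fin d)) ⁻¹' s).indicator
          (fun _ => (1 : ℝ)) x ∂P = (S J).real s) := fun J hJ =>
      have := (hS J hJ).1
      map_eq_iff_integral_indicator (measurable_restrict_coords J)
    constructor
    · rintro ⟨⟨hprob, hunif⟩, hJ', hK'⟩ c
        (rfl | ⟨ℓ, s, hs, rfl⟩ | ⟨J, hJ, s, hs, rfl⟩ | ⟨K, hK, rfl⟩)
      · exact isProbabilityMeasure_iff_integral_one.1 hprob
      · exact (map_eq_iff_integral_indicator (measurable_pi_apply ℓ)).1 (hunif ℓ) s hs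
      · exact (hmargin J hJ).1 (hJ' J hJ) s hs
      · exact (hgint K hK).symm.trans (hK' K hK)
    · intro h
      refine ⟨⟨isProbabilityMeasure_iff_integral_one.2 (h _ (Or.inl rfl)), fun ℓ => ?_⟩,
        fun J hJ => ?_, fun K hK => ?_⟩
      · exact (map_eq_iff_integral_indicator (measurable_pi_apply ℓ)).2
          fun s hs => h _ (Or.inr (Or.inl ⟨ℓ, s, hs, rfl⟩))
      · exact (hmargin J hJ).2 fun s hs => h _ (Or.inr (Or.inr (Or.inl ⟨J, hJ, s, hs, rfl⟩)))
      · exact (hgint K hK).trans (h _ (Or.inr (Or.inr (Or.inr ⟨K, hK, rfl⟩))))
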